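/- Let μ, d ≥ 0 and L > 0. There exists a Borel probability measure P supported in [0, L] with mean ∫ x dP = μ and mean absolute deviation ∫ |x − μ| dP = d if and only if d ≤ 2μ(L − μ)/L. -/

import Mathlib

open MeasureTheory

lemma stmt16_bwd (μ d L p q : ℝ) (hμ : 0 ≤ μ) (hL : 0 < L) (hμL : μ ≤ L)
    (hp : 0 ≤ p) (hq : 0 ≤ q) (hpq : p + q ≤ 1) (h1 : p * μ = d / 2) (h2 : q * (L - μ) = d / 2) :
    ∃ P : Measure ℝ, IsProbabilityMeasure P ∧ P (Set.Icc 0 L) = 1 ∧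
      (∫ x, x ∂P) = μ ∧ (∫ x, |x - μ| ∂P) = d := by
  have hr : 0 ≤ 1 - p - q := by linarith
  have hsum : ENNReal.ofReal p + ENNReal.ofReal q + ENNReal.ofReal (1 - p - q) = 1 := by
    rw [← ENNReal.ofReal_add hp hq, ← ENNReal.ofReal_add (by linarith) hr, ← ENNReal.ofReal_one]
    congr 1; ring
  have hint : ∀ f : ℝ → ℝ, ∀ a c : ℝ,
      Integrable f (ENNReal.ofReal c • Measure.dirac a) := fun f a c =>
    (integrable_dirac (by simp)).smul_measure ENNReal.ofReal_ne_top
  have key : ∀ f : ℝ → ℝ, ∫ x, f x ∂(ENNReal.ofReal p • Measure.dirac (0:ℝ) +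
      ENNReal.ofReal q • Measure.dirac L + ENNReal.ofReal (1 - p - q) • Measure.dirac μ)
      = p * f 0 + q * f L + (1 - p - q) * f μ := by
    intro f
    rw [integral_add_measure ((hint f _ _).add_measure (hint f _ _)) (hint f _ _),
      integral_add_measure (hint f _ _) (hint f _ _)]
    simp only [integral_smul_measure, integral_dirac, ENNReal.toReal_ofReal hp,
      ENNReal.toReal_ofReal hq, ENNReal.toReal_ofReal hr, smul_eq_mul]
  refine ⟨_, ⟨?_⟩, ?_, (key _).trans ?_, (key _).trans ?_⟩
  · simpa using hsum
  · have a1 : (0:ℝ) ∈ Set.Icc 0 L := ⟨le_rfl, hL.le⟩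
    have a2 : L ∈ Set.Icc 0 L := ⟨hL.le, le_rfl⟩
    have a3 : μ ∈ Set.Icc 0 L := ⟨hμ, hμL⟩
    simp only [Measure.add_apply, Measure.smul_apply, Measure.dirac_apply_of_mem a1,
      Measure.dirac_apply_of_mem a2, Measure.dirac_apply_of_mem a3, smul_eq_mul, mul_one]
    exact hsum
  · linarith
  · rw [sub_self, abs_zero, zero_sub, abs_neg, abs_of_nonneg hμ, abs_of_nonneg (sub_nonneg.2 hμL)]
    linarith

theorem stmt16 (μ d L : ℝ) (hμ : 0 ≤ μ) (hd : 0 ≤ d) (hL : 0 < L) :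
    (∃ P : Measure ℝ, IsProbabilityMeasure P ∧ P (Set.Icc 0 L) = 1 ∧
      (∫ x, x ∂P) = μ ∧ (∫ x, |x - μ| ∂P) = d) ↔ d ≤ 2 * μ * (L - μ) / L := by
  rw [le_div_iff₀ hL]
  constructor
  · rintro ⟨P, hP, hs, hm, hdd⟩
    have hae : ∀ᵐ x ∂P, x ∈ Set.Icc 0 L := (prob_compl_eq_zero_iff measurableSet_Icc).2 hs
    have hi : Integrable (fun x : ℝ => x) P := by
      refine Integrable.of_bound (C := L) (by fun_prop) ?_
      filter_upwards [hae] with x hx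
      rw [Real.norm_eq_abs, abs_of_nonneg hx.1]; exact hx.2
    have hμL : μ ≤ L := by
      have := integral_mono_ae hi (integrable_const L) (hae.mono fun x hx => hx.2)
      simpa [hm] using this
    have hmono : ∫ x, |x - μ| * L ∂P ≤ ∫ x, (μ * L + x * (L - 2 * μ)) ∂P := by
      refine integral_mono_ae ((hi.sub (integrable_const μ)).abs.mul_const L)
        ((integrable_const _).add (hi.mul_const _)) ?_
      filter_upwards [hae] with x hx
      show |x - μ| * L ≤ μ * L + x * (L - 2 * μ)
      rcases le_total μ x with h | h
      · rw [abs_of_nonneg (by linarith)]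
        nlinarith [mul_nonneg hμ (sub_nonneg.2 hx.2)]
      · rw [abs_of_nonpos (by linarith)]
        nlinarith [mul_nonneg hx.1 (sub_nonneg.2 hμL)]
    rw [integral_mul_const, hdd, integral_add (integrable_const _) (hi.mul_const _),
      integral_mul_const, integral_mul_const, hm] at hmono
    simp at hmono
    linarith
  · intro h
    have hdL : 0 ≤ d * L := by positivity
    have hμL : μ ≤ L := by
      by_contra hc
      push Not at hc
      nlinarith [mul_pos (hL.trans hc) (sub_pos.2 hc)]
    rcases (mul_nonneg hμ (sub_nonneg.2 hμL)).eq_or_lt with h0 | h0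
    · have hd0 : d = 0 := by
        have : d * L = 0 := by nlinarith
        exact (mul_eq_zero.1 this).resolve_right hL.ne'
      exact stmt16_bwd μ d L 0 0 hμ hL hμL le_rfl le_rfl (by norm_num) (by simp [hd0])
        (by simp [hd0])
    · have p1 : 0 < μ := hμ.lt_of_ne (by rintro rfl; simp at h0)
      have p2 : 0 < L - μ := pos_of_mul_pos_right h0 hμ
      refine stmt16_bwd μ d L (d / 2 / μ) (d / 2 / (L - μ)) hμ hL hμL (by positivity)
        (by positivity) ?_ (div_mul_cancel₀ _ p1.ne') (div_mul_cancel₀ _ p2.ne')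
      rw [div_add_div _ _ p1.ne' p2.ne', div_le_one h0]
      linarith
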